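/- arXiv:1601.03628 — 2 statements merged into one kernel-verified Lean document; each statement's English description precedes it below -/
import Mathlib

section
/- Let Ω be a finite set with |Ω| = n, let k be a divisor of n with k ≥ 1, let L be a family of k-subsets of Ω with incidence vector χ, set x = |L| / C(n−1, k−1) (as a rational number), and let K be the Kneser (disjointness) matrix of k-subsets of Ω. Then L is a Cameron-Liebler class of k-sets with parameter x in Ω if and only if K · (χ − (kx/n)·j) = −C(n−k−1, k−1) · (χ − (kx/n)·j), where j is the all-one vector indexed by the k-subsets of Ω; that is, χ − (kx/n)·j lies in the eigenspace of K for the eigenvalue −C(n−k−1, k−1). -/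
/-- A `k`-uniform partition of the finite ground set `α`: a family of pairwise disjoint
`k`-subsets such that every element lies in exactly one member. -/
def IsUniformPartition {α : Type*} [Fintype α] [DecidableEq α] (k : ℕ)
    (P : Finset (Finset α)) : Prop :=
  (∀ A ∈ P, A.card = k) ∧ ∀ a : α, ∃! A, A ∈ P ∧ a ∈ A

/-- A Cameron-Liebler class of `k`-sets with (rational) parameter `x`: a family of
`k`-subsets meeting every `k`-uniform partition in exactly `x` members. -/
def IsCameronLieblerQ {α : Type*} [Fintype α] [DecidableEq α] (k : ℕ) (x : ℚ)
    (L : Finset (Finset α)) : Prop :=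
  (∀ A ∈ L, A.card = k) ∧
    ∀ P : Finset (Finset α), IsUniformPartition k P → ((L ∩ P).card : ℚ) = x

open Finset

section UniformPartition

variable {α : Type*} [Fintype α] [DecidableEq α] {k : ℕ}

namespace IsUniformPartition

theorem disjoint {P : Finset (Finset α)} (hP : IsUniformPartition k P) {A B : Finset α}
    (hA : A ∈ P) (hB : B ∈ P) (hAB : A ≠ B) : Disjoint A B := by
  rw [Finset.disjoint_left]
  intro a haA haB
  exact hAB ((hP.2 a).unique ⟨hA, haA⟩ ⟨hB, haB⟩)

theorem card_mul {P : Finset (Finset α)} (hP : IsUniformPartition k P) :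
    P.card * k = Fintype.card α := by
  have hU : P.biUnion id = univ := by
    ext a
    obtain ⟨A, hA, -⟩ := hP.2 a
    simpa using ⟨A, hA⟩
  rw [← Finset.card_univ, ← hU,
    Finset.card_biUnion (t := id) fun A hA B hB h => hP.disjoint hA hB h]
  exact (Finset.sum_const_nat hP.1).symm

theorem map {P : Finset (Finset α)} (hP : IsUniformPartition k P) (σ : Equiv.Perm α) :
    IsUniformPartition k (P.image (Finset.image σ)) := by
  refine ⟨?_, fun a => ?_⟩
  · intro A hA
    obtain ⟨B, hB, rfl⟩ := Finset.mem_image.1 hA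
    rw [Finset.card_image_of_injective _ σ.injective, hP.1 B hB]
  · obtain ⟨A, ⟨hA, ha⟩, huniq⟩ := hP.2 (σ.symm a)
    refine ⟨A.image σ, ⟨Finset.mem_image_of_mem _ hA, ?_⟩, ?_⟩
    · exact Finset.mem_image.2 ⟨_, ha, by simp⟩
    · rintro B ⟨hB, haB⟩
      obtain ⟨C, hC, rfl⟩ := Finset.mem_image.1 hB
      obtain ⟨b, hb, rfl⟩ := Finset.mem_image.1 haB
      rw [huniq C ⟨hC, by simpa using hb⟩]

end IsUniformPartition

theorem exists_isUniformPartition (h : k ∣ Fintype.card α) :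
    ∃ P : Finset (Finset α), IsUniformPartition k P := by
  obtain ⟨m, hm⟩ := h
  have e : α ≃ Fin m × Fin k := Fintype.equivOfCardEq (by simp [hm, mul_comm])
  have hcard (i : Fin m) : (univ.filter fun a => (e a).1 = i).card = k := by
    have : (univ.filter fun a => (e a).1 = i) =
        (univ : Finset (Fin k)).image fun t => e.symm (i, t) := by
      ext a
      simp only [mem_filter, mem_univ, true_and, mem_image]
      constructor
      · rintro rfl
        exact ⟨(e a).2, by simp⟩
      · rintro ⟨t, rfl⟩
        simp
    rw [this, Finset.card_image_of_injective _ fun s t hst => by simpa using hst]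
    simp
  refine ⟨univ.image fun i : Fin m => univ.filter fun a => (e a).1 = i, ?_, fun a => ?_⟩
  · intro A hA
    obtain ⟨i, -, rfl⟩ := Finset.mem_image.1 hA
    exact hcard i
  · refine ⟨univ.filter fun b => (e b).1 = (e a).1, ⟨by simp, by simp⟩, ?_⟩
    rintro B ⟨hB, haB⟩
    obtain ⟨i, -, rfl⟩ := Finset.mem_image.1 hB
    simp only [mem_filter, mem_univ, true_and] at haB
    rw [haB]

/-- The symmetric group is transitive on ordered pairs of disjoint sets of prescribed sizes. -/
theorem exists_perm_image_eq_of_disjoint {A B A' B' : Finset α} (hAB : Disjoint A B)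
    (hAB' : Disjoint A' B') (hA : A.card = A'.card) (hB : B.card = B'.card) :
    ∃ σ : Equiv.Perm α, A.image σ = A' ∧ B.image σ = B' := by
  let e₁ := Finset.equivOfCardEq hA
  let e₂ := Finset.equivOfCardEq hB
  let f : α → α := fun a =>
    if ha : a ∈ A then e₁ ⟨a, ha⟩ else if hb : a ∈ B then e₂ ⟨a, hb⟩ else a
  have hfA : ∀ a (ha : a ∈ A), f a = e₁ ⟨a, ha⟩ := fun a ha => dif_pos ha
  have hfB : ∀ a (hb : a ∈ B), f a = e₂ ⟨a, hb⟩ := fun a hb => by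
    simp only [f]
    rw [dif_neg (Finset.disjoint_right.1 hAB hb), dif_pos hb]
  have hmemA : ∀ a ∈ A, f a ∈ A' := fun a ha => hfA a ha ▸ (e₁ ⟨a, ha⟩).2
  have hmemB : ∀ a ∈ B, f a ∈ B' := fun a hb => hfB a hb ▸ (e₂ ⟨a, hb⟩).2
  have hinj : Set.InjOn f (A ∪ B : Finset α) := by
    intro a ha b hb hab
    rcases Finset.mem_union.1 ha with ha | ha <;> rcases Finset.mem_union.1 hb with hb | hb
    · rw [hfA a ha, hfA b hb] at hab
      exact congrArg Subtype.val (e₁.injective (Subtype.ext hab))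
    · exact absurd (hab ▸ hmemB b hb) (Finset.disjoint_left.1 hAB' (hmemA a ha))
    · exact absurd (hab ▸ hmemB a ha) (Finset.disjoint_left.1 hAB' (hmemA b hb))
    · rw [hfB a ha, hfB b hb] at hab
      exact congrArg Subtype.val (e₂.injective (Subtype.ext hab))
  obtain ⟨g, hg⟩ := Finset.exists_equiv_extend_of_card_eq (t := (univ : Finset α))
    Finset.card_univ.symm (Finset.subset_univ _) hinj
  have key : ∃ σ : Equiv.Perm α, ∀ a : α, (a ∈ A → σ a ∈ A') ∧ (a ∈ B → σ a ∈ B') := by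
    refine ⟨g.trans (Equiv.subtypeUnivEquiv Finset.mem_univ), fun a => ⟨fun ha => ?_, fun ha => ?_⟩⟩
    · simpa [hg a (Finset.mem_union_left B ha)] using hmemA a ha
    · simpa [hg a (Finset.mem_union_right A ha)] using hmemB a ha
  obtain ⟨σ, hσ⟩ := key
  refine ⟨σ, Finset.eq_of_subset_of_card_le ?_ ?_, Finset.eq_of_subset_of_card_le ?_ ?_⟩
  · exact Finset.image_subset_iff.2 fun a ha => (hσ a).1 ha
  · rw [Finset.card_image_of_injective _ σ.injective, hA]
  · exact Finset.image_subset_iff.2 fun a ha => (hσ a).2 ha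
  · rw [Finset.card_image_of_injective _ σ.injective, hB]

open Classical in
/-- The finset of all `k`-uniform partitions. -/
noncomputable def uniformPartitions (α : Type*) [Fintype α] [DecidableEq α] (k : ℕ) :
    Finset (Finset (Finset α)) :=
  univ.filter (IsUniformPartition k)

theorem mem_uniformPartitions {P : Finset (Finset α)} :
    P ∈ uniformPartitions α k ↔ IsUniformPartition k P := by
  simp [uniformPartitions]

theorem card_uniformPartitions_through_le {A B A' B' : Finset α} (hAB : Disjoint A B)
    (hAB' : Disjoint A' B') (hA : A.card = A'.card) (hB : B.card = B'.card) :
    ((uniformPartitions α k).filter fun P => A ∈ P ∧ B ∈ P).card ≤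
      ((uniformPartitions α k).filter fun P => A' ∈ P ∧ B' ∈ P).card := by
  obtain ⟨σ, rfl, rfl⟩ := exists_perm_image_eq_of_disjoint hAB hAB' hA hB
  refine Finset.card_le_card_of_injOn (Finset.image (Finset.image σ)) ?_ ?_
  · intro P hP
    simp only [coe_filter, Set.mem_ofPred_eq, mem_uniformPartitions] at hP ⊢
    exact ⟨hP.1.map σ, Finset.mem_image_of_mem _ hP.2.1, Finset.mem_image_of_mem _ hP.2.2⟩
  · exact (Finset.image_injective (Finset.image_injective σ.injective)).injOn

theorem exists_card_uniformPartitions_through_eq {m : ℕ} (hk : k ≠ 0) (hm : 2 ≤ m)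
    (hcard : Fintype.card α = k * m) :
    ∃ c : ℕ, 0 < c ∧ ∀ A B : Finset α, A.card = k → B.card = k → Disjoint A B →
      ((uniformPartitions α k).filter fun P => A ∈ P ∧ B ∈ P).card = c := by
  obtain ⟨P, hP⟩ := exists_isUniformPartition (α := α) ⟨m, hcard⟩
  have hPm : P.card = m := by
    have := hP.card_mul
    rw [hcard, mul_comm] at this
    exact Nat.eq_of_mul_eq_mul_left (Nat.pos_of_ne_zero hk) this
  obtain ⟨A, hA, B, hB, hAB⟩ := Finset.one_lt_card.1 (by omega : 1 < P.card)
  refine ⟨((uniformPartitions α k).filter fun P => A ∈ P ∧ B ∈ P).card,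
    Finset.card_pos.2 ⟨P, Finset.mem_filter.2 ⟨mem_uniformPartitions.2 hP, hA, hB⟩⟩,
    fun A' B' hA' hB' h => ?_⟩
  have hd := hP.disjoint hA hB hAB
  have h₁ : A'.card = A.card := by rw [hA', hP.1 A hA]
  have h₂ : B'.card = B.card := by rw [hB', hP.1 B hB]
  exact le_antisymm (card_uniformPartitions_through_le h hd h₁ h₂)
    (card_uniformPartitions_through_le hd h h₁.symm h₂.symm)

theorem sum_uniformPartitions_sum_erase {c : ℕ} (hk : k ≠ 0)
    (hc : ∀ A B : Finset α, A.card = k → B.card = k → Disjoint A B →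
      ((uniformPartitions α k).filter fun P => A ∈ P ∧ B ∈ P).card = c)
    {A : Finset α} (hA : A.card = k) (W : Finset α → ℚ) :
    ∑ P ∈ (uniformPartitions α k).filter (fun P => A ∈ P), ∑ B ∈ P.erase A, W B =
      c * ∑ B ∈ (powersetCard k univ).filter (fun B => Disjoint A B), W B := by
  rw [Finset.sum_comm' (t' := (powersetCard k univ).filter (fun B => Disjoint A B))
    (s' := fun B => (uniformPartitions α k).filter fun P => A ∈ P ∧ B ∈ P), Finset.mul_sum]
  · refine Finset.sum_congr rfl fun B hB => ?_
    simp only [mem_filter, mem_powersetCard, subset_univ, true_and] at hB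
    rw [Finset.sum_const, hc A B hA hB.1 hB.2, nsmul_eq_mul]
  · intro P B
    simp only [mem_filter, mem_uniformPartitions, mem_erase, mem_powersetCard, subset_univ,
      true_and]
    constructor
    · rintro ⟨⟨hP, hAP⟩, hne, hBP⟩
      exact ⟨⟨hP, hAP, hBP⟩, hP.1 B hBP, hP.disjoint hAP hBP hne.symm⟩
    · rintro ⟨⟨hP, hAP, hBP⟩, -, hd⟩
      refine ⟨⟨hP, hAP⟩, ?_, hBP⟩
      rintro rfl
      rw [disjoint_self, Finset.bot_eq_empty] at hd
      simp [hd] at hA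
      exact hk hA.symm

theorem card_powersetCard_filter_disjoint {A : Finset α} (hA : A.card = k) :
    ((powersetCard k (univ : Finset α)).filter fun B => Disjoint A B).card =
      (Fintype.card α - k).choose k := by
  have : (powersetCard k (univ : Finset α)).filter (fun B => Disjoint A B) =
      powersetCard k Aᶜ := by
    ext B
    simp only [mem_filter, mem_powersetCard, subset_univ, true_and]
    rw [Finset.subset_compl_comm, Finset.subset_compl_iff_disjoint_right]
    tauto
  rw [this, card_powersetCard, card_compl, hA]

/-- A function on `k`-sets sums to zero over every `k`-uniform partition if and only if it is an
eigenvector of the Kneser matrix for the eigenvalue `-(n - k - 1).choose (k - 1)`. -/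
theorem sum_disjoint_eq_iff_sum_uniformPartition_eq_zero {m : ℕ} (hk : k ≠ 0) (hm : 2 ≤ m)
    (hcard : Fintype.card α = k * m) (V : Finset α → ℚ) :
    (∀ A : Finset α, A.card = k →
      ∑ B ∈ (powersetCard k univ).filter (fun B => Disjoint A B), V B =
        -((Fintype.card α - k - 1).choose (k - 1) : ℚ) * V A) ↔
      ∀ P, IsUniformPartition k P → ∑ B ∈ P, V B = 0 := by
  obtain ⟨c, hc0, hc⟩ := exists_card_uniformPartitions_through_eq hk hm hcard
  have hc0' : (c : ℚ) ≠ 0 := by exact_mod_cast hc0.ne'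
  have hN : ∀ A : Finset α, A.card = k →
      (((uniformPartitions α k).filter (fun P => A ∈ P)).card : ℚ) =
        c * ((Fintype.card α - k - 1).choose (k - 1) : ℚ) := by
    intro A hA
    have h := sum_uniformPartitions_sum_erase hk hc hA fun _ => 1
    simp only [Finset.sum_const, nsmul_eq_mul, mul_one] at h
    rw [card_powersetCard_filter_disjoint hA, Finset.sum_congr rfl (g := fun _ => (m : ℚ) - 1),
      Finset.sum_const, nsmul_eq_mul] at h
    · have hch : ((Fintype.card α - k).choose k : ℚ) =
          ((m : ℚ) - 1) * ((Fintype.card α - k - 1).choose (k - 1) : ℚ) := by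
        obtain ⟨l, rfl⟩ : ∃ l, k = l + 1 := ⟨k - 1, by omega⟩
        obtain ⟨r, rfl⟩ : ∃ r, m = r + 2 := ⟨m - 2, by omega⟩
        have h1 : Fintype.card α - (l + 1) = (l + 1) * (r + 1) := by
          rw [hcard, Nat.sub_eq_iff_eq_add (by nlinarith)]; ring
        obtain ⟨t, ht⟩ : ∃ t, (l + 1) * (r + 1) = t + 1 := ⟨l * r + l + r, by ring⟩
        rw [h1, ht]
        have h2 := Nat.add_one_mul_choose_eq t l
        rw [← ht] at h2
        have h3 : (t + 1).choose (l + 1) = (r + 1) * t.choose l := by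
          apply Nat.eq_of_mul_eq_mul_left (Nat.succ_pos l)
          rw [← ht, Nat.succ_eq_add_one]
          linarith
        rw [h3]
        push_cast
        ring
      rw [hch] at h
      have hm1 : (m : ℚ) - 1 ≠ 0 := by
        have : (2 : ℚ) ≤ m := by exact_mod_cast hm
        linarith
      apply mul_right_cancel₀ hm1
      rw [h]; ring
    · intro P hP
      obtain ⟨hP, hAP⟩ := Finset.mem_filter.1 hP
      have hPm : P.card = m := by
        have := (mem_uniformPartitions.1 hP).card_mul
        rw [hcard, mul_comm] at this
        exact Nat.eq_of_mul_eq_mul_left (Nat.pos_of_ne_zero hk) this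
      rw [Finset.card_erase_of_mem hAP, hPm, Nat.cast_sub (by omega)]
      simp
  have hg : ∀ A : Finset α, A.card = k →
      ∑ P ∈ (uniformPartitions α k).filter (fun P => A ∈ P), ∑ B ∈ P, V B =
        c * (((Fintype.card α - k - 1).choose (k - 1) : ℚ) * V A +
          ∑ B ∈ (powersetCard k univ).filter (fun B => Disjoint A B), V B) := by
    intro A hA
    rw [mul_add, ← sum_uniformPartitions_sum_erase hk hc hA V, ← mul_assoc, ← hN A hA,
      ← nsmul_eq_mul, ← Finset.sum_const, ← Finset.sum_add_distrib]
    exact Finset.sum_congr rfl fun P hP =>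
      (Finset.add_sum_erase P V (Finset.mem_filter.1 hP).2).symm
  constructor
  · intro h
    have hsq : ∑ P ∈ uniformPartitions α k, (∑ B ∈ P, V B) ^ 2 = 0 := by
      have : ∑ P ∈ uniformPartitions α k, (∑ B ∈ P, V B) ^ 2 =
          ∑ P ∈ uniformPartitions α k, ∑ A ∈ P, V A * ∑ B ∈ P, V B :=
        Finset.sum_congr rfl fun P _ => by rw [sq, Finset.sum_mul]
      rw [this, Finset.sum_comm' (t' := powersetCard k univ)
        (s' := fun A => (uniformPartitions α k).filter fun P => A ∈ P)]
      · refine Finset.sum_eq_zero fun A hA => ?_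
        have hA' : A.card = k := (mem_powersetCard.1 hA).2
        rw [← Finset.mul_sum, hg A hA', h A hA']
        ring
      · intro P A
        simp only [mem_filter, mem_uniformPartitions, mem_powersetCard, subset_univ, true_and]
        exact ⟨fun h => ⟨h, h.1.1 A h.2⟩, fun h => h.1⟩
    intro P hP
    exact pow_eq_zero_iff (two_ne_zero) |>.1 <|
      (Finset.sum_eq_zero_iff_of_nonneg fun P _ => sq_nonneg _).1 hsq P
        (mem_uniformPartitions.2 hP)
  · intro h A hA
    have h0 := hg A hA
    rw [Finset.sum_eq_zero fun P hP => h P (mem_uniformPartitions.1 (Finset.mem_filter.1 hP).1)]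
      at h0
    have := (mul_eq_zero.1 h0.symm).resolve_left hc0'
    linarith

end UniformPartition

theorem stmt_7 {α : Type*} [Fintype α] [DecidableEq α] {n k : ℕ}
    (hn : Fintype.card α = n) (hdvd : k ∣ n) (hk1 : 1 ≤ k)
    (L : Finset (Finset α)) (hL : ∀ A ∈ L, A.card = k)
    (x : ℚ) (hx : x = (L.card : ℚ) / ((n - 1).choose (k - 1) : ℚ))
    (K : Matrix {A : Finset α // A.card = k} {A : Finset α // A.card = k} ℚ)
    (hK : ∀ A B, K A B = if Disjoint A.1 B.1 then 1 else 0)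
    (χ : {A : Finset α // A.card = k} → ℚ)
    (hχ : ∀ A, χ A = if A.1 ∈ L then 1 else 0)
    (j : {A : Finset α // A.card = k} → ℚ) (hj : ∀ A, j A = 1) :
    IsCameronLieblerQ k x L ↔
      K.mulVec (χ - ((k : ℚ) * x / (n : ℚ)) • j) =
        (-(((n - k - 1).choose (k - 1) : ℚ))) • (χ - ((k : ℚ) * x / (n : ℚ)) • j) := by
  have hk0 : k ≠ 0 := by omega
  have hkQ : (k : ℚ) ≠ 0 := by exact_mod_cast hk0
  obtain ⟨m, hm⟩ := hdvd
  set V : Finset α → ℚ := fun A => (if A ∈ L then 1 else 0) - (k : ℚ) * x / (n : ℚ) with hV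
  have hv : χ - ((k : ℚ) * x / (n : ℚ)) • j = fun A => V A.1 := by
    funext A
    simp [hV, hχ, hj]
  have hRHS : (K.mulVec (χ - ((k : ℚ) * x / (n : ℚ)) • j) =
        (-(((n - k - 1).choose (k - 1) : ℚ))) • (χ - ((k : ℚ) * x / (n : ℚ)) • j)) ↔
      ∀ A : Finset α, A.card = k →
        ∑ B ∈ (powersetCard k univ).filter (fun B => Disjoint A B), V B =
          -((n - k - 1).choose (k - 1) : ℚ) * V A := by
    rw [hv, funext_iff, Subtype.forall]
    refine forall₂_congr fun A hA => ?_
    simp only [Matrix.mulVec, dotProduct, hK, Pi.smul_apply, smul_eq_mul]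
    rw [Finset.sum_filter, Finset.sum_subtype (F := Subtype.fintype _)
      (p := fun B : Finset α => B.card = k)
      (s := powersetCard k univ) (h := fun B => by simp [mem_powersetCard])]
    simp only [ite_mul, one_mul, zero_mul]
  rw [hRHS]
  rcases Nat.eq_zero_or_pos m with rfl | hm0
  · have hn0 : n = 0 := by simpa using hm
    have hno : ∀ A : Finset α, A.card ≠ k := by
      intro A hA
      have := A.card_le_univ
      omega
    have hL0 : L = ∅ := Finset.eq_empty_of_forall_notMem fun A hA => hno A (hL A hA)
    refine ⟨fun _ A hA => absurd hA (hno A), fun _ => ⟨hL, fun P _ => ?_⟩⟩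
    simp [hx, hL0]
  have hn0 : (n : ℚ) ≠ 0 := by
    rw [hm]; push_cast
    exact mul_ne_zero hkQ (by exact_mod_cast hm0.ne')
  have hLHS : IsCameronLieblerQ k x L ↔
      ∀ P, IsUniformPartition k P → ∑ B ∈ P, V B = 0 := by
    rw [IsCameronLieblerQ, and_iff_right hL]
    refine forall₂_congr fun P hP => ?_
    have hPk : (P.card : ℚ) * k = n := by
      rw [← hn, ← hP.card_mul]; push_cast; rfl
    have hs : ∑ B ∈ P, V B = ((L ∩ P).card : ℚ) - x := by
      simp only [hV, Finset.sum_sub_distrib, Finset.sum_const, nsmul_eq_mul]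
      rw [Finset.sum_boole, Finset.filter_mem_eq_inter, Finset.inter_comm, ← mul_div_assoc,
        ← mul_assoc, hPk, mul_div_cancel_left₀ _ hn0]
    rw [hs, sub_eq_zero]
  rw [hLHS]
  rcases Nat.lt_or_ge m 2 with hm2 | hm2
  · obtain rfl : m = 1 := by omega
    obtain rfl : n = k := by omega
    have huniv : ∀ A : Finset α, A.card = n → A = univ := fun A hA =>
      (Finset.card_eq_iff_eq_univ A).1 (hA.trans hn.symm)
    have hV0 : ∀ A : Finset α, A.card = n → V A = 0 := by
      intro A hA
      have hx' : x = L.card := by simp [hx]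
      simp only [hV]
      rw [mul_div_cancel_left₀ _ hn0, hx']
      split_ifs with h
      · have : L = {A} := Finset.eq_singleton_iff_unique_mem.2
          ⟨h, fun B hB => (huniv B (hL B hB)).trans (huniv A hA).symm⟩
        simp [this]
      · have : L = ∅ := Finset.eq_empty_of_forall_notMem fun B hB =>
          h (by rwa [huniv A hA, ← huniv B (hL B hB)])
        simp [this]
    refine ⟨fun _ A hA => ?_, fun _ P hP => Finset.sum_eq_zero fun B hB => hV0 B (hP.1 B hB)⟩
    rw [hV0 A hA, mul_zero]
    refine Finset.sum_eq_zero fun B hB => hV0 B ?_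
    exact (mem_powersetCard.1 (Finset.mem_filter.1 hB).1).2
  · have := sum_disjoint_eq_iff_sum_uniformPartition_eq_zero hk0 hm2 (hn.trans hm) V
    rw [hn] at this
    exact this.symm
end

section
/- Let Ω be a finite set with |Ω| = n, let k be a divisor of n with k ≥ 2 and n ≥ 3k, and let L be a Cameron-Liebler class of k-sets with parameter n/k − 1 in Ω. Then L is the family of all k-subsets of Ω not containing some fixed element p ∈ Ω. -/
/-- A Cameron-Liebler class of `k`-sets with parameter `x`: a family of `k`-subsets meeting
every `k`-uniform partition in exactly `x` members. -/
def IsCameronLiebler {α : Type*} [Fintype α] [DecidableEq α] (k x : ℕ)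
    (L : Finset (Finset α)) : Prop :=
  (∀ A ∈ L, A.card = k) ∧
    ∀ P : Finset (Finset α), IsUniformPartition k P → (L ∩ P).card = x

theorem Finset.exists_card_eq_disjoint {α : Type*} [Fintype α] [DecidableEq α]
    (S : Finset α) {j : ℕ} (h : S.card + j ≤ Fintype.card α) :
    ∃ D : Finset α, D.card = j ∧ Disjoint D S := by
  have hc : j ≤ Sᶜ.card := by rw [Finset.card_compl]; omega
  obtain ⟨D, hD, hj⟩ := Finset.exists_subset_card_eq hc
  exact ⟨D, hj, Finset.disjoint_left.2 fun a ha => Finset.mem_compl.1 (hD ha)⟩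

/-- A set of size `m * k` splits into `m` blocks of size `k`. -/
theorem Finset.exists_uniform_split {α : Type*} [DecidableEq α] {k : ℕ} (hk : 0 < k) (m : ℕ)
    (S : Finset α) (hS : S.card = m * k) :
    ∃ Q : Finset (Finset α), Q.card = m ∧ (∀ A ∈ Q, A.card = k ∧ A ⊆ S) ∧
      ∀ a ∈ S, ∃! A, A ∈ Q ∧ a ∈ A := by
  induction m generalizing S with
  | zero =>
    have : S = ∅ := by simpa using hS
    exact ⟨∅, by simp, by simp, by simp [this]⟩
  | succ m ih =>
    obtain ⟨A, hAS, hA⟩ := Finset.exists_subset_card_eq (s := S) (n := k) (by rw [hS]; nlinarith)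
    obtain ⟨Q, hQm, hQ, hQu⟩ := ih (S \ A) (by
      rw [Finset.card_sdiff_of_subset hAS, hS, hA, Nat.succ_mul]; omega)
    have hAQ : A ∉ Q := fun h => by
      obtain ⟨a, ha⟩ := Finset.card_pos.1 (hA ▸ hk)
      exact (Finset.mem_sdiff.1 ((hQ A h).2 ha)).2 ha
    refine ⟨insert A Q, by rw [Finset.card_insert_of_notMem hAQ, hQm], ?_, ?_⟩
    · intro B hB
      rcases Finset.mem_insert.1 hB with rfl | hB
      · exact ⟨hA, hAS⟩
      · exact ⟨(hQ B hB).1, (hQ B hB).2.trans Finset.sdiff_subset⟩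
    · intro a ha
      by_cases haA : a ∈ A
      · refine ⟨A, ⟨by simp, haA⟩, ?_⟩
        rintro B ⟨hB, haB⟩
        rcases Finset.mem_insert.1 hB with rfl | hB
        · rfl
        · exact absurd haA (Finset.mem_sdiff.1 ((hQ B hB).2 haB)).2
      · obtain ⟨B, ⟨hB, haB⟩, hu⟩ := hQu a (Finset.mem_sdiff.2 ⟨ha, haA⟩)
        refine ⟨B, ⟨by simp [hB], haB⟩, ?_⟩
        rintro B' ⟨hB', haB'⟩
        rcases Finset.mem_insert.1 hB' with rfl | hB'
        · exact absurd haB' haA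
        · exact hu B' ⟨hB', haB'⟩

/-- Two disjoint `k`-sets in a Cameron-Liebler class contribute to it the parameter, minus a count
that depends only on their union. -/
theorem IsCameronLiebler.exists_pair_count {α : Type*} [Fintype α] [DecidableEq α] {k x m : ℕ}
    (hk : 0 < k) (hn : Fintype.card α = (m + 2) * k) {L : Finset (Finset α)}
    (hL : IsCameronLiebler k x L) (U : Finset α) (hU : U.card = 2 * k) :
    ∃ c ≤ m, ∀ A B : Finset α, A.card = k → B.card = k → Disjoint A B → A ∪ B = U →
      (if A ∈ L then 1 else 0) + (if B ∈ L then 1 else 0) + c = x := by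
  obtain ⟨Q, hQm, hQ, hQu⟩ := Finset.exists_uniform_split hk m Uᶜ (by
    rw [Finset.card_compl, hn, hU, Nat.add_mul]; omega)
  refine ⟨(L ∩ Q).card, hQm ▸ Finset.card_le_card Finset.inter_subset_right, ?_⟩
  rintro A B hA hB hAB rfl
  have hout : ∀ D ∈ Q, ∀ a ∈ D, a ∉ A ∧ a ∉ B := fun D hD a ha => by
    simpa using (hQ D hD).2 ha
  obtain ⟨a, ha⟩ := Finset.card_pos.1 (hA ▸ hk)
  obtain ⟨b, hb⟩ := Finset.card_pos.1 (hB ▸ hk)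
  have hAQ : A ∉ Q := fun h => (hout A h a ha).1 ha
  have hBQ : B ∉ Q := fun h => (hout B h b hb).2 hb
  have hne : A ≠ B := by
    rintro rfl
    exact Finset.disjoint_left.1 hAB ha ha
  have hP : IsUniformPartition k (insert A (insert B Q)) := by
    refine ⟨by simpa [hA, hB] using fun D hD => (hQ D hD).1, fun p => ?_⟩
    by_cases hpA : p ∈ A
    · refine ⟨A, ⟨by simp, hpA⟩, ?_⟩
      rintro D ⟨hD, hpD⟩
      simp only [Finset.mem_insert] at hD
      rcases hD with rfl | rfl | hD
      · rfl
      · exact absurd hpD (Finset.disjoint_left.1 hAB hpA)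
      · exact absurd hpA (hout D hD p hpD).1
    by_cases hpB : p ∈ B
    · refine ⟨B, ⟨by simp, hpB⟩, ?_⟩
      rintro D ⟨hD, hpD⟩
      simp only [Finset.mem_insert] at hD
      rcases hD with rfl | rfl | hD
      · exact absurd hpD hpA
      · rfl
      · exact absurd hpB (hout D hD p hpD).2
    obtain ⟨D, ⟨hD, hpD⟩, hu⟩ := hQu p (by simp [hpA, hpB])
    refine ⟨D, ⟨by simp [hD], hpD⟩, ?_⟩
    rintro D' ⟨hD', hpD'⟩
    simp only [Finset.mem_insert] at hD'
    rcases hD' with rfl | rfl | hD'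
    · exact absurd hpD' hpA
    · exact absurd hpD' hpB
    · exact hu D' ⟨hD', hpD'⟩
  rw [← hL.2 _ hP]
  by_cases h1 : A ∈ L <;> by_cases h2 : B ∈ L <;>
    simp [Finset.inter_insert_of_mem, Finset.inter_insert_of_notMem, h1, h2, hAQ, hBQ, hne] <;>
    omega

/-- Some exchange of a single element leads from outside a family of `k`-sets into it. -/
theorem Finset.exists_exchange {α : Type*} [DecidableEq α] {j : ℕ} {L : Finset (Finset α)}
    (hL : ∀ A ∈ L, A.card = j + 1) (hne : L.Nonempty) {A : Finset α} (hA : A.card = j + 1)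
    (hAL : A ∉ L) :
    ∃ (C : Finset α) (x y : α), C.card = j ∧ x ∉ C ∧ y ∉ C ∧ x ≠ y ∧
      insert x C ∉ L ∧ insert y C ∈ L := by
  obtain ⟨B, hB, hmin⟩ := Finset.exists_min_image L (fun B => (A \ B).card) hne
  have hBA : B ≠ A := by rintro rfl; exact hAL hB
  obtain ⟨x, hx⟩ : (A \ B).Nonempty := Finset.sdiff_nonempty.2 fun h =>
    hBA (Finset.eq_of_subset_of_card_le h (by rw [hA, hL B hB])).symm
  obtain ⟨y, hy⟩ : (B \ A).Nonempty := Finset.sdiff_nonempty.2 fun h =>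
    hBA (Finset.eq_of_subset_of_card_le h (by rw [hA, hL B hB]))
  rw [Finset.mem_sdiff] at hx hy
  have hxy : x ≠ y := by rintro rfl; exact hx.2 hy.1
  refine ⟨B.erase y, x, y, by rw [Finset.card_erase_of_mem hy.1, hL B hB]; rfl,
    by simp [hx.2], by simp, hxy, fun h => ?_, by rwa [Finset.insert_erase hy.1]⟩
  refine (hmin _ h).not_gt (Finset.card_lt_card ?_)
  refine (Finset.ssubset_iff_of_subset fun a ha => ?_).2
    ⟨x, Finset.mem_sdiff.2 hx, by simp⟩
  simp only [Finset.mem_sdiff, Finset.mem_insert, Finset.mem_erase, not_or, not_and] at ha ⊢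
  exact ⟨ha.1, ha.2.2 (by rintro rfl; exact hy.2 ha.1)⟩

/-- If the complement of a family of `(j + 1)`-sets is intersecting, and the exchange behaviour of
two elements is the same over disjoint `j`-sets, then the family consists of the sets avoiding
some point. -/
theorem Finset.exists_eq_filter_notMem_of_exchange {α : Type*} [Fintype α] [DecidableEq α]
    {j : ℕ} (hn : 3 * (j + 1) ≤ Fintype.card α) {L : Finset (Finset α)}
    (hL : ∀ A ∈ L, A.card = j + 1) (hne : L.Nonempty)
    (hout : ∃ A : Finset α, A.card = j + 1 ∧ A ∉ L)
    (hint : ∀ A B : Finset α, A.card = j + 1 → B.card = j + 1 → Disjoint A B → A ∉ L → B ∈ L)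
    (hswap : ∀ (C D : Finset α) (x y : α), C.card = j → D.card = j → x ∉ C → y ∉ C →
      x ∉ D → y ∉ D → x ≠ y → Disjoint C D → insert x C ∉ L → insert y C ∈ L →
      insert x D ∉ L ∧ insert y D ∈ L) :
    ∃ p : α, L = (Finset.powersetCard (j + 1) Finset.univ).filter (fun A => p ∉ A) := by
  have hswap' : ∀ (C D : Finset α) (x y : α), C.card = j → D.card = j → x ∉ C → y ∉ C →
      x ∉ D → y ∉ D → x ≠ y → insert x C ∉ L → insert y C ∈ L →
      insert x D ∉ L ∧ insert y D ∈ L := by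
    intro C D x y hC hD hxC hyC hxD hyD hxy h1 h2
    obtain ⟨E, hE, hdis⟩ := Finset.exists_card_eq_disjoint (insert x (insert y (C ∪ D))) (j := j)
      (by
        have := Finset.card_insert_le x (insert y (C ∪ D))
        have := Finset.card_insert_le y (C ∪ D)
        have := Finset.card_union_le C D
        omega)
    simp only [Finset.disjoint_insert_right, Finset.disjoint_union_right] at hdis
    obtain ⟨hxE, hyE, hEC, hED⟩ := hdis
    obtain ⟨h3, h4⟩ := hswap C E x y hC hE hxC hyC hxE hyE hxy hEC.symm h1 h2
    exact hswap E D x y hE hD hxE hyE hxD hyD hxy hED h3 h4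
  obtain ⟨A, hA, hAL⟩ := hout
  obtain ⟨C₀, x, y, hC₀, hxC₀, hyC₀, hxy, hx₀, hy₀⟩ := Finset.exists_exchange hL hne hA hAL
  have hdom : ∀ D : Finset α, D.card = j → x ∉ D → y ∉ D → insert x D ∉ L ∧ insert y D ∈ L :=
    fun D hD hxD hyD => hswap' C₀ D x y hC₀ hD hxC₀ hyC₀ hxD hyD hxy hx₀ hy₀
  have hstar : ∀ C : Finset α, C.card = j → x ∉ C → insert x C ∉ L := by
    intro C hC hxC hCL
    have hyC : y ∈ C := by
      by_contra hyC
      exact (hdom C hC hxC hyC).1 hCL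
    obtain ⟨Z, hZ, hZd⟩ := Finset.exists_card_eq_disjoint (insert x C) (j := 1)
      (by have := Finset.card_insert_le x C; omega)
    obtain ⟨z, rfl⟩ := Finset.card_eq_one.1 hZ
    simp only [Finset.disjoint_singleton_left, Finset.mem_insert, not_or] at hZd
    obtain ⟨hzx, hzC⟩ := hZd
    have hzy : z ≠ y := by rintro rfl; exact hzC hyC
    obtain ⟨D, hD, hDd⟩ := Finset.exists_card_eq_disjoint ({x, y, z} : Finset α) (j := j)
      (by have := Finset.card_le_three (a := x) (b := y) (c := z); omega)
    simp only [Finset.disjoint_insert_right, Finset.disjoint_singleton_right] at hDd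
    obtain ⟨hxD, hyD, hzD⟩ := hDd
    obtain ⟨h1, h2⟩ := hdom D hD hxD hyD
    have hzL : insert z D ∉ L := fun h =>
      (hswap' D C x z hD hC hxD hzD hxC hzC (Ne.symm hzx) h1 h).1 hCL
    obtain ⟨E, hE, hEd⟩ := Finset.exists_card_eq_disjoint (({x, y, z} : Finset α) ∪ D) (j := j)
      (by
        have := Finset.card_le_three (a := x) (b := y) (c := z)
        have := Finset.card_union_le {x, y, z} D
        omega)
    simp only [Finset.disjoint_union_right, Finset.disjoint_insert_right,
      Finset.disjoint_singleton_right] at hEd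
    obtain ⟨⟨hxE, hyE, hzE⟩, hED⟩ := hEd
    refine (hdom E hE hxE hyE).1 (hint (insert z D) (insert x E) ?_ ?_ ?_ hzL)
    · rw [Finset.card_insert_of_notMem hzD, hD]
    · rw [Finset.card_insert_of_notMem hxE, hE]
    · simp only [Finset.disjoint_insert_left, Finset.disjoint_insert_right, Finset.mem_insert,
        not_or]
      exact ⟨⟨Ne.symm hzx, hxD⟩, hzE, hED.symm⟩
  refine ⟨x, Finset.ext fun K => ?_⟩
  simp only [Finset.mem_filter, Finset.mem_powersetCard, Finset.subset_univ, true_and]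
  constructor
  · refine fun hK => ⟨hL K hK, fun hxK => hstar (K.erase x) ?_ (by simp) ?_⟩
    · rw [Finset.card_erase_of_mem hxK, hL K hK]; rfl
    · rwa [Finset.insert_erase hxK]
  · rintro ⟨hK, hxK⟩
    obtain ⟨C, hC, hCd⟩ := Finset.exists_card_eq_disjoint (insert x K) (j := j)
      (by have := Finset.card_insert_le x K; omega)
    simp only [Finset.disjoint_insert_right] at hCd
    refine hint (insert x C) K ?_ hK ?_ (hstar C hC hCd.1)
    · rw [Finset.card_insert_of_notMem hCd.1, hC]
    · simpa [Finset.disjoint_insert_left, hxK] using hCd.2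

theorem stmt_12 {α : Type*} [Fintype α] [DecidableEq α] {n k : ℕ}
    (hn : Fintype.card α = n) (hdvd : k ∣ n) (hk2 : 2 ≤ k) (h3k : 3 * k ≤ n)
    (L : Finset (Finset α)) (hCL : IsCameronLiebler k (n / k - 1) L) :
    ∃ p : α, L = (Finset.powersetCard k Finset.univ).filter (fun A => p ∉ A) := by
  obtain ⟨q, rfl⟩ := hdvd
  have hk : 0 < k := by omega
  have hq : 3 ≤ q := by nlinarith
  obtain ⟨m, rfl⟩ : ∃ m, q = m + 2 := ⟨q - 2, by omega⟩
  rw [Nat.mul_div_cancel_left _ hk] at hCL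
  obtain ⟨j, rfl⟩ : ∃ j, k = j + 1 := ⟨k - 1, by omega⟩
  have hpair := fun A B (hA : A.card = j + 1) (hB : B.card = j + 1) (hAB : Disjoint A B) =>
    hCL.exists_pair_count hk (hn.trans (mul_comm _ _)) (A ∪ B)
      (by rw [Finset.card_union_of_disjoint hAB]; omega)
  have hint : ∀ A B : Finset α, A.card = j + 1 → B.card = j + 1 → Disjoint A B →
      A ∉ L → B ∈ L := by
    intro A B hA hB hAB hAL
    obtain ⟨c, hc, h⟩ := hpair A B hA hB hAB
    have := h A B hA hB hAB rfl
    by_contra hBL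
    simp only [hAL, hBL, if_false] at this
    omega
  obtain ⟨Q, hQm, hQ, hQu⟩ := Finset.exists_uniform_split hk (m + 2) (Finset.univ : Finset α)
    (by rw [Finset.card_univ, hn, mul_comm])
  have hcount := hCL.2 Q ⟨fun A hA => (hQ A hA).1, fun a => hQu a (Finset.mem_univ a)⟩
  refine Finset.exists_eq_filter_notMem_of_exchange (hn ▸ h3k) hCL.1 ?_ ?_ hint ?_
  · obtain ⟨A, hA⟩ : (L ∩ Q).Nonempty := Finset.card_pos.1 (by omega)
    exact ⟨A, (Finset.mem_inter.1 hA).1⟩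
  · by_contra! hall
    have : L ∩ Q = Q := Finset.inter_eq_right.2 fun A hA => hall A (hQ A hA).1
    rw [this] at hcount
    omega
  · intro C D x y hC hD hxC hyC hxD hyD hxy hCD h1 h2
    have hcard : ∀ {E : Finset α} {z : α}, E.card = j → z ∉ E → (insert z E).card = j + 1 :=
      fun hE hz => by rw [Finset.card_insert_of_notMem hz, hE]
    have hdis : ∀ {z w : α}, z ≠ w → z ∉ D → w ∉ C → Disjoint (insert z C) (insert w D) := by
      intro z w hzw hz hw
      simp only [Finset.disjoint_insert_left, Finset.disjoint_insert_right, Finset.mem_insert,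
        not_or]
      exact ⟨⟨hzw.symm, hw⟩, hz, hCD⟩
    obtain ⟨c, -, h⟩ := hpair _ _ (hcard hC hxC) (hcard hD hyD) (hdis hxy hxD hyC)
    have e1 := h _ _ (hcard hC hxC) (hcard hD hyD) (hdis hxy hxD hyC) rfl
    have e2 := h _ _ (hcard hC hyC) (hcard hD hxD) (hdis hxy.symm hyD hxC) (by
      ext a; simp only [Finset.mem_union, Finset.mem_insert]; tauto)
    simp only [h1, h2, if_true, if_false] at e1 e2
    split_ifs at e1 e2 <;> first | omega | exact ⟨‹_›, ‹_›⟩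
end
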